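/- arXiv:2505.16760 — 3 statements merged into one kernel-verified Lean document; each statement's English description precedes it below -/
import Mathlib

section
/- For every natural number k, the SU(2)_k modular S-matrix S (the real (k+1)×(k+1) matrix with entries S a b = √(2/(k+2)) · sin((a+1)(b+1)π/(k+2))) satisfies S² = 1, and consequently the modular relation S⁴ = 1. -/
open scoped Real

/-- The `SU(2)_k` modular S-matrix: the real `(k+1) × (k+1)` matrix with entries
`S a b = √(2/(k+2)) · sin((a+1)(b+1)π/(k+2))`. -/
noncomputable def SU2smatrix (k : ℕ) : Matrix (Fin (k + 1)) (Fin (k + 1)) ℝ :=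
  fun a b =>
    Real.sqrt (2 / (k + 2)) *
      Real.sin (((a : ℕ) + 1) * ((b : ℕ) + 1) * π / (k + 2))

/-- Closed form of `∑ cos (jθ)` over `j < n` at `θ = mπ/n`, away from multiples of `2π`. -/
lemma sum_range_cos_int_mul_pi_div (n : ℕ) (m : ℤ) (h₀ : m ≠ 0) (h : |m| < 2 * n) :
    ∑ j ∈ Finset.range n, Real.cos (j * (m * π / n)) = (1 - (-1) ^ m) / 2 := by
  have hm : (0 : ℤ) < |m| := abs_pos.mpr h₀
  have hn : (0 : ℝ) < n := by
    have : 0 < n := by omega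
    exact_mod_cast this
  have hs : Real.sin (m * π / n / 2) ≠ 0 := by
    intro hsin
    obtain ⟨q, hq⟩ := Real.sin_eq_zero_iff.mp hsin
    have hq' : m = 2 * n * q := by
      field_simp at hq
      exact_mod_cast (by linarith : (m : ℝ) = 2 * n * q)
    have hdvd : (2 * n : ℤ) ∣ m := ⟨q, hq'⟩
    exact h₀ (Int.eq_zero_of_abs_lt_dvd hdvd h)
  have hsum := Real.sin_mul_sum_cos n (m * π / n) 0
  have hprod := Real.two_mul_sin_mul_cos (n * (m * π / n) / 2) ((n - 1) * (m * π / n) / 2)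
  rw [show n * (m * π / n) / 2 - (n - 1) * (m * π / n) / 2 = m * π / n / 2 by ring,
    show n * (m * π / n) / 2 + (n - 1) * (m * π / n) / 2 = m * π - m * π / n / 2 by
      field_simp; ring, Real.sin_int_mul_pi_sub] at hprod
  simp only [add_zero, mul_comm (m * π / n : ℝ)] at hsum
  apply mul_left_cancel₀ (mul_ne_zero two_ne_zero hs)
  linear_combination 2 * hsum + hprod

/-- Discrete orthogonality of the sine functions. -/
lemma sum_range_sin_mul_sin (n a b : ℕ) (ha₀ : 0 < a) (hb₀ : 0 < b) (ha : a < n) (hb : b < n) :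
    ∑ j ∈ Finset.range n, Real.sin (a * j * π / n) * Real.sin (j * b * π / n) =
      if a = b then (n : ℝ) / 2 else 0 := by
  have hprod (j : ℕ) : Real.sin (a * j * π / n) * Real.sin (j * b * π / n) =
      (Real.cos (j * (((a - b : ℤ) : ℝ) * π / n)) -
        Real.cos (j * (((a + b : ℤ) : ℝ) * π / n))) / 2 := by
    push_cast
    rw [show (j : ℝ) * ((a - b) * π / n) = a * j * π / n - j * b * π / n by ring,
      show (j : ℝ) * ((a + b) * π / n) = a * j * π / n + j * b * π / n by ring,
      Real.cos_sub, Real.cos_add]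
    ring
  simp_rw [hprod]
  rw [← Finset.sum_div, Finset.sum_sub_distrib,
    sum_range_cos_int_mul_pi_div n (a + b) (by omega) (by rw [abs_lt]; omega)]
  split_ifs with hab
  · subst hab
    simp [(Even.add_self (a : ℤ)).neg_one_zpow]
  · rw [sum_range_cos_int_mul_pi_div n (a - b) (by omega) (by rw [abs_lt]; omega),
      show (a + b : ℤ) = (a - b) + (b + b) by ring, zpow_add₀ (by norm_num),
      (Even.add_self (b : ℤ)).neg_one_zpow]
    ring

/-- The `SU(2)_k` modular S-matrix satisfies `S² = 1`, and consequently `S⁴ = 1`. -/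
theorem SU2_smatrix_sq_one (k : ℕ) :
    SU2smatrix k ^ 2 = 1 ∧ SU2smatrix k ^ 4 = 1 := by
  have hsq : SU2smatrix k ^ 2 = 1 := by
    ext a b
    have horth := sum_range_sin_mul_sin (k + 2) (a + 1) (b + 1) (by omega) (by omega)
      (by omega) (by omega)
    rw [Finset.sum_range_succ', ← Fin.sum_univ_eq_sum_range (fun j =>
      Real.sin ((a + 1 : ℕ) * (j + 1 : ℕ) * π / (k + 2 : ℕ)) *
        Real.sin ((j + 1 : ℕ) * (b + 1 : ℕ) * π / (k + 2 : ℕ)))] at horth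
    push_cast at horth
    simp only [mul_zero, zero_mul, zero_div, Real.sin_zero, add_zero,
      Fin.val_inj] at horth
    rw [sq, Matrix.mul_apply]
    simp only [SU2smatrix, mul_mul_mul_comm √(2 / ((k : ℝ) + 2)) _ √(2 / ((k : ℝ) + 2))]
    rw [← Finset.mul_sum, horth, Real.mul_self_sqrt (by positivity), Matrix.one_apply]
    split_ifs
    · field_simp
    · simp
  exact ⟨hsq, by rw [show 4 = 2 * 2 from rfl, pow_mul, hsq, one_pow]⟩
end

section
/- For every natural number k, the explicit SU(2)_k modular matrices satisfy the modular group relation (S·T)³ = S², where S is the (k+1)×(k+1) complex matrix with entries S a b = √(2/(k+2)) · sin((a+1)(b+1)π/(k+2)) and T is the diagonal matrix with entries T a a = exp(2πi·(a(a+2)/(4(k+2)) − k/(8(k+2)))). -/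
open scoped Real

/-- The `SU(2)_k` modular S-matrix viewed as a complex matrix:
`S a b = √(2/(k+2)) · sin((a+1)(b+1)π/(k+2))`. -/
noncomputable def SU2smatrixC (k : ℕ) : Matrix (Fin (k + 1)) (Fin (k + 1)) ℂ :=
  fun a b =>
    ((Real.sqrt (2 / (k + 2)) *
        Real.sin (((a : ℕ) + 1) * ((b : ℕ) + 1) * π / (k + 2)) : ℝ) : ℂ)

/-- The `SU(2)_k` modular T-matrix: the diagonal matrix with entries
`T a a = exp(2πi·(a(a+2)/(4(k+2)) − k/(8(k+2))))`, coming from the conformal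
weight `h_a = a(a+2)/(4(k+2))` and central charge `c = 3k/(k+2)`. -/
noncomputable def SU2tmatrix (k : ℕ) : Matrix (Fin (k + 1)) (Fin (k + 1)) ℂ :=
  fun a b =>
    if a = b then
      Complex.exp (2 * (π : ℂ) * Complex.I *
        (((a : ℕ) : ℂ) * (((a : ℕ) : ℂ) + 2) / (4 * ((k : ℂ) + 2)) -
          (k : ℂ) / (8 * ((k : ℂ) + 2))))
    else 0

open Filter Topology HurwitzZeta

/-- The quadratic phase `exp(πi n²/M)`. -/
noncomputable def quadPhase (M : ℕ) (n : ℤ) : ℂ :=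
  Complex.exp (π * Complex.I * (n : ℂ) ^ 2 / M)

lemma quadPhase_add_mul (M : ℕ) [NeZero M] (hM : Even M) (n m : ℤ) :
    quadPhase M (m * M + n) = quadPhase M n := by
  obtain ⟨N, hN⟩ := hM
  have hM0 : (M : ℂ) ≠ 0 := NeZero.ne _
  have hN' : (M : ℂ) = N + N := by rw [hN]; push_cast; ring
  rw [quadPhase, quadPhase, Complex.exp_eq_exp_iff_exists_int]
  refine ⟨m ^ 2 * N + m * n, ?_⟩
  push_cast
  field_simp
  linear_combination (m:ℂ)^2 * (M:ℂ) * hN'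

lemma norm_quadPhase (M : ℕ) (n : ℤ) : ‖quadPhase M n‖ = 1 := by
  rw [quadPhase, show (π * Complex.I * (n : ℂ) ^ 2 / M : ℂ) =
    ((π * n ^ 2 / M : ℝ) : ℂ) * Complex.I by push_cast; ring, Complex.norm_exp_ofReal_mul_I]

/-- Splitting a Gaussian sum with periodic coefficients into residue classes. -/
lemma tsum_periodic_mul_gaussian (M : ℕ) [NeZero M] (c : ℤ → ℂ)
    (hc : ∀ n m : ℤ, c (m * M + n) = c n) (hb : ∀ n, ‖c n‖ ≤ 1) {t : ℝ} (ht : 0 < t) :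
    ∑' n : ℤ, c n * (Real.exp (-π * (n : ℝ) ^ 2 * t) : ℂ) =
      ∑ r : Fin M, c (r : ℕ) * (evenKernel (((r : ℕ) / M : ℝ) : UnitAddCircle) (M ^ 2 * t) : ℂ) := by
  have hM : (0 : ℝ) < M := by exact_mod_cast Nat.pos_of_ne_zero (NeZero.ne M)
  have hs : Summable fun n : ℤ ↦ c n * (Real.exp (-π * (n : ℝ) ^ 2 * t) : ℂ) := by
    have h := (hasSum_int_evenKernel 0 ht).summable
    simp only [add_zero] at h
    refine Summable.of_norm_bounded h fun n ↦ ?_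
    rw [norm_mul, Complex.norm_real, Real.norm_eq_abs, Real.abs_exp]
    exact mul_le_of_le_one_left (Real.exp_pos _).le (hb n)
  let e := ((Int.divModEquiv M).trans (Equiv.prodComm _ _)).symm
  have hp := Summable.tsum_prod (e.summable_iff.mpr hs)
  rw [← e.tsum_eq]
  refine hp.trans ((tsum_fintype _).trans ?_)
  refine Finset.sum_congr rfl fun r _ ↦ ?_
  have h := (hasSum_int_evenKernel ((r : ℕ) / M : ℝ) (t := M ^ 2 * t) (by positivity))
  rw [← Complex.hasSum_ofReal] at h
  rw [← (h.mul_left (c (r : ℕ))).tsum_eq]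
  refine tsum_congr fun m ↦ ?_
  have he : e (r, m) = m * M + (r : ℕ) := by simp [e]
  rw [Function.comp, he, hc]
  congr 3
  push_cast
  field_simp

lemma tendsto_evenKernel_atTop (a : UnitAddCircle) [Decidable (a = 0)] :
    Tendsto (evenKernel a) atTop (𝓝 (if a = 0 then 1 else 0)) := by
  obtain ⟨p, hp, h⟩ := isBigO_atTop_evenKernel_sub a
  have h0 : Tendsto (fun x : ℝ ↦ Real.exp (-p * x)) atTop (𝓝 0) := by
    refine Real.tendsto_exp_atBot.comp ?_
    exact tendsto_id.const_mul_atTop_of_neg (by linarith)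
  have := (h.trans_tendsto h0).add_const (if a = 0 then 1 else 0)
  by_cases ha : a = 0 <;> simpa [ha] using this

lemma tendsto_cosKernel_atTop (a : UnitAddCircle) :
    Tendsto (cosKernel a) atTop (𝓝 1) := by
  obtain ⟨p, hp, h⟩ := isBigO_atTop_cosKernel_sub a
  have h0 : Tendsto (fun x : ℝ ↦ Real.exp (-p * x)) atTop (𝓝 0) := by
    refine Real.tendsto_exp_atBot.comp ?_
    exact tendsto_id.const_mul_atTop_of_neg (by linarith)
  have := (h.trans_tendsto h0).add_const 1
  simpa only [sub_add_cancel, zero_add] using this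

lemma tendsto_sqrt_mul_evenKernel (a : UnitAddCircle) {M : ℝ} (hM : 0 < M) :
    Tendsto (fun x ↦ √x * evenKernel a (M ^ 2 * x)) (𝓝[>] 0) (𝓝 (1 / M)) := by
  have h1 : Tendsto (fun x : ℝ ↦ 1 / (M ^ 2 * x)) (𝓝[>] 0) atTop := by
    have := tendsto_inv_nhdsGT_zero (𝕜 := ℝ) |>.const_mul_atTop (show 0 < 1 / M ^ 2 by positivity)
    refine this.congr fun x ↦ ?_
    rw [one_div, one_div, mul_inv]
  have h2 := ((tendsto_cosKernel_atTop a).comp h1).const_mul (1 / M)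
  rw [mul_one] at h2
  refine h2.congr' ?_
  filter_upwards [self_mem_nhdsWithin] with x (hx : 0 < x)
  rw [evenKernel_functional_equation, ← Real.sqrt_eq_rpow, Real.sqrt_mul (by positivity),
    Real.sqrt_sq hM.le, Function.comp]
  have := (Real.sqrt_pos.mpr hx).ne'
  field_simp

lemma ofReal_mul_cpow_half {x : ℝ} (hx : 0 < x) {w : ℂ} (hw : w ≠ 0) :
    ((x : ℂ) * w) ^ (1 / 2 : ℂ) = (√x : ℝ) * w ^ (1 / 2 : ℂ) := by
  have hx' : (x : ℂ) ≠ 0 := by exact_mod_cast hx.ne'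
  rw [Complex.cpow_def_of_ne_zero (mul_ne_zero hx' hw), Complex.log_ofReal_mul hx hw, add_mul,
    Complex.exp_add, Complex.cpow_def_of_ne_zero hw, Real.sqrt_eq_rpow, Real.rpow_def_of_pos hx]
  push_cast
  ring_nf

lemma theta_reciprocity (M : ℕ) [NeZero M] (hM : Even M) {x : ℝ} (hx : 0 < x) :
    ∑ r : Fin M, quadPhase M (r : ℕ) *
        ((√x * evenKernel (((r : ℕ) / M : ℝ) : UnitAddCircle) (M ^ 2 * x) : ℝ) : ℂ) =
      1 / ((x - Complex.I / M) ^ (1 / 2 : ℂ) *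
          (M ^ 2 / (1 + Complex.I * M * x)) ^ (1 / 2 : ℂ)) *
        ∑ r : Fin M, (starRingEnd ℂ) (quadPhase M (r : ℕ)) *
          (evenKernel (((r : ℕ) / M : ℝ) : UnitAddCircle) (1 / x) : ℂ) := by
  have hM0 : (M : ℂ) ≠ 0 := NeZero.ne _
  have hMp : (0 : ℝ) < M := by exact_mod_cast Nat.pos_of_ne_zero (NeZero.ne M)
  have hx0 : (x : ℂ) ≠ 0 := by exact_mod_cast hx.ne'
  have hsx : ((√x : ℝ) : ℂ) ≠ 0 := by exact_mod_cast (Real.sqrt_pos.mpr hx).ne'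
  have hd : (1 + Complex.I * M * x : ℂ) ≠ 0 := by
    intro h
    simpa using congrArg Complex.re h
  set a : ℂ := x - Complex.I / M with ha
  set w : ℂ := M ^ 2 / (1 + Complex.I * M * x) with hw
  have hw0 : w ≠ 0 := div_ne_zero (pow_ne_zero _ hM0) hd
  have hare : a.re = x := by simp [ha]
  have ha0 : a ≠ 0 := fun h ↦ by rw [h] at hare; exact hx.ne hare
  have hinv : 1 / (x * w) = ((1 / (M ^ 2 * x) : ℝ) : ℂ) + Complex.I / M := by
    rw [hw]; push_cast; field_simp
  have hs : x * w = 1 / a - Complex.I * M := by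
    have had : a = (1 + Complex.I * M * x) / (Complex.I * M) := by
      rw [ha, eq_div_iff (mul_ne_zero Complex.I_ne_zero hM0)]
      field_simp
      linear_combination -Complex.I_sq
    rw [hw, had]
    generalize hD : (1 + Complex.I * M * x : ℂ) = d at hd
    field_simp
    linear_combination -Complex.I * hD + x * M * Complex.I_sq
  have hsre : 0 < (x * w).re := by
    have h1 : 0 < (1 / (x * w)).re := by
      rw [hinv]
      simp only [Complex.add_re, Complex.ofReal_re]
      have : (Complex.I / M : ℂ).re = 0 := by simp
      rw [this]; positivity
    rw [one_div, Complex.inv_re] at h1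
    have := Complex.normSq_nonneg (x * w)
    by_contra! hcon
    exact absurd h1 (not_lt.mpr (div_nonpos_of_nonpos_of_nonneg hcon this))
  have h1 := Complex.tsum_exp_neg_mul_int_sq (a := a) (by rw [hare]; exact hx)
  have h2 := Complex.tsum_exp_neg_mul_int_sq hsre
  have e1 : ∀ n : ℤ, Complex.exp (-π * a * (n : ℂ) ^ 2) =
      quadPhase M n * (Real.exp (-π * (n : ℝ) ^ 2 * x) : ℂ) := fun n ↦ by
    rw [quadPhase, Complex.ofReal_exp, ← Complex.exp_add, ha]
    congr 1
    push_cast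
    ring
  have e2 : ∀ n : ℤ, Complex.exp (-π / a * (n : ℂ) ^ 2) =
      Complex.exp (-π * (x * w) * (n : ℂ) ^ 2) := fun n ↦ by
    obtain ⟨N, hN⟩ := hM
    have hN' : (M : ℂ) = N + N := by rw [hN]; push_cast; ring
    rw [Complex.exp_eq_exp_iff_exists_int]
    refine ⟨-(n ^ 2 * N), ?_⟩
    rw [hs]
    push_cast
    linear_combination (-π * Complex.I * (n : ℂ) ^ 2) * hN'
  have e3 : ∀ n : ℤ, Complex.exp (-π / (x * w) * (n : ℂ) ^ 2) =
      (starRingEnd ℂ) (quadPhase M n) * (Real.exp (-π * (n : ℝ) ^ 2 * (1 / (M ^ 2 * x))) : ℂ) :=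
    fun n ↦ by
    rw [quadPhase, ← Complex.exp_conj, Complex.ofReal_exp, ← Complex.exp_add, div_eq_mul_one_div,
      hinv]
    congr 1
    simp only [map_div₀, map_mul, map_pow, Complex.conj_ofReal, Complex.conj_I, map_intCast,
      map_natCast]
    push_cast
    ring
  simp_rw [e1, e2] at h1
  simp_rw [e3] at h2
  rw [h2, tsum_periodic_mul_gaussian M _ (fun n m ↦ quadPhase_add_mul M hM n m)
    (fun n ↦ (norm_quadPhase M n).le) hx, tsum_periodic_mul_gaussian M _
    (fun n m ↦ by rw [quadPhase_add_mul M hM n m])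
    (fun n ↦ by rw [RCLike.norm_conj, norm_quadPhase]) (by positivity),
    ofReal_mul_cpow_half hx hw0, show (M : ℝ) ^ 2 * (1 / (M ^ 2 * x)) = 1 / x by field_simp] at h1
  have h3 : ∀ r : Fin M, quadPhase M (r : ℕ) *
        ((√x * evenKernel (((r : ℕ) / M : ℝ) : UnitAddCircle) (M ^ 2 * x) : ℝ) : ℂ) =
      (√x : ℝ) * (quadPhase M (r : ℕ) *
        (evenKernel (((r : ℕ) / M : ℝ) : UnitAddCircle) (M ^ 2 * x) : ℂ)) := fun r ↦ by
    push_cast; ring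
  simp_rw [h3]
  rw [← Finset.mul_sum, h1]
  have := (Complex.cpow_ne_zero_iff_of_exponent_ne_zero (y := 1 / 2) (by norm_num)).mpr ha0
  have := (Complex.cpow_ne_zero_iff_of_exponent_ne_zero (y := 1 / 2) (by norm_num)).mpr hw0
  field_simp

/-- Evaluation of the quadratic Gauss sum of even modulus. -/
lemma sum_quadPhase (M : ℕ) [NeZero M] (hM : Even M) :
    ∑ r : Fin M, quadPhase M (r : ℕ) = (√M : ℝ) * Complex.exp (π / 4 * Complex.I) := by
  classical
  have hM0 : (M : ℂ) ≠ 0 := NeZero.ne _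
  have hMp : (0 : ℝ) < M := by exact_mod_cast Nat.pos_of_ne_zero (NeZero.ne M)
  have hL : Tendsto (fun x : ℝ ↦ ∑ r : Fin M, quadPhase M (r : ℕ) *
        ((√x * evenKernel (((r : ℕ) / M : ℝ) : UnitAddCircle) (M ^ 2 * x) : ℝ) : ℂ)) (𝓝[>] 0)
      (𝓝 (∑ r : Fin M, quadPhase M (r : ℕ) * ((1 / M : ℝ) : ℂ))) :=
    tendsto_finsetSum _ fun r _ ↦ ((Complex.continuous_ofReal.tendsto _).comp
      (tendsto_sqrt_mul_evenKernel _ hMp)).const_mul _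
  have hx : Tendsto (fun x : ℝ ↦ (x : ℂ)) (𝓝[>] 0) (𝓝 0) :=
    (Complex.continuous_ofReal.tendsto' 0 0 Complex.ofReal_zero).mono_left nhdsWithin_le_nhds
  have hR : Tendsto (fun x : ℝ ↦ ∑ r : Fin M, (starRingEnd ℂ) (quadPhase M (r : ℕ)) *
          (evenKernel (((r : ℕ) / M : ℝ) : UnitAddCircle) (1 / x) : ℂ)) (𝓝[>] 0)
      (𝓝 (∑ r : Fin M, (starRingEnd ℂ) (quadPhase M (r : ℕ)) *
        ((if (((r : ℕ) / M : ℝ) : UnitAddCircle) = 0 then 1 else 0 : ℝ) : ℂ))) :=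
    tendsto_finsetSum _ fun r _ ↦ ((Complex.continuous_ofReal.tendsto _).comp
      ((tendsto_evenKernel_atTop _).comp
        (tendsto_inv_nhdsGT_zero.congr fun x ↦ (one_div x).symm))).const_mul _
  have hR1 : ∑ r : Fin M, (starRingEnd ℂ) (quadPhase M (r : ℕ)) *
      ((if (((r : ℕ) / M : ℝ) : UnitAddCircle) = 0 then 1 else 0 : ℝ) : ℂ) = 1 := by
    rw [Finset.sum_eq_single (0 : Fin M)]
    · simp [quadPhase]
    · intro r _ hr
      rw [if_neg, Complex.ofReal_zero, mul_zero]
      rw [AddCircle.coe_eq_zero_iff]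
      rintro ⟨n, hn⟩
      rw [zsmul_one, eq_div_iff hMp.ne'] at hn
      have hn' : n * M = ((r : ℕ) : ℤ) := by exact_mod_cast hn
      have hlt : ((r : ℕ) : ℤ) < M := by exact_mod_cast r.2
      have h0 := Int.eq_zero_of_abs_lt_dvd (m := M) (x := ((r : ℕ) : ℤ)) ⟨n, by rw [← hn']; ring⟩
        (by rw [abs_of_nonneg (by positivity)]; exact hlt)
      exact hr (Fin.ext (by simpa using h0))
    · simp
  rw [hR1] at hR
  have hA : Tendsto (fun x : ℝ ↦ ((x : ℂ) - Complex.I / M) ^ (1 / 2 : ℂ)) (𝓝[>] 0)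
      (𝓝 ((0 - Complex.I / M) ^ (1 / 2 : ℂ))) := by
    refine (hx.sub_const _).cpow tendsto_const_nhds (Or.inr ?_)
    simp [NeZero.ne]
  have hW : Tendsto (fun x : ℝ ↦ ((M : ℂ) ^ 2 / (1 + Complex.I * M * x)) ^ (1 / 2 : ℂ)) (𝓝[>] 0)
      (𝓝 ((M ^ 2 / (1 + Complex.I * M * 0)) ^ (1 / 2 : ℂ))) := by
    refine (tendsto_const_nhds.div ((hx.const_mul _).const_add _) (by simp)).cpow
      tendsto_const_nhds (Or.inl ?_)
    simp only [mul_zero, add_zero, div_one]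
    norm_cast
    exact pow_pos (Nat.pos_of_ne_zero (NeZero.ne M)) 2
  have hA1 : (0 - Complex.I / M) ^ (1 / 2 : ℂ) =
      (√(1 / M) : ℝ) * Complex.exp (-(π / 4 * Complex.I)) := by
    rw [show (0 - Complex.I / M : ℂ) = ((1 / M : ℝ) : ℂ) * (-Complex.I) by push_cast; ring,
      ofReal_mul_cpow_half (by positivity) (by simp), Complex.cpow_def_of_ne_zero (by simp),
      Complex.log_neg_I]
    ring_nf
  have hW1 : ((M : ℂ) ^ 2 / (1 + Complex.I * M * 0)) ^ (1 / 2 : ℂ) = M := by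
    rw [show ((M : ℂ) ^ 2 / (1 + Complex.I * M * 0)) = (((M : ℝ) ^ 2 : ℝ) : ℂ) * 1 by
      push_cast; simp, ofReal_mul_cpow_half (by positivity) one_ne_zero, Real.sqrt_sq hMp.le]
    simp
  have hne : (0 - Complex.I / M) ^ (1 / 2 : ℂ) *
      ((M : ℂ) ^ 2 / (1 + Complex.I * M * 0)) ^ (1 / 2 : ℂ) ≠ 0 := by
    rw [hA1, hW1]
    refine mul_ne_zero (mul_ne_zero ?_ (Complex.exp_ne_zero _)) hM0
    exact_mod_cast (Real.sqrt_pos.mpr (by positivity)).ne'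
  have hlim := tendsto_nhds_unique
    (hL.congr' (by
      filter_upwards [self_mem_nhdsWithin] with x hx
      exact theta_reciprocity M hM hx))
    ((tendsto_const_nhds.div (hA.mul hW) hne).mul hR)
  rw [hA1, hW1, ← Finset.sum_mul, Complex.exp_neg] at hlim
  have hsq : ((√M : ℝ) : ℂ) ^ 2 = M := by
    rw [← Complex.ofReal_pow, Real.sq_sqrt hMp.le, Complex.ofReal_natCast]
  have hexp := Complex.exp_ne_zero (π / 4 * Complex.I)
  rw [Real.sqrt_div zero_le_one, Real.sqrt_one] at hlim
  push_cast at hlim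
  field_simp at hlim
  rw [hlim, div_mul_eq_mul_div]

lemma quadPhase_add (M : ℕ) (n m : ℤ) :
    quadPhase M (n + m) =
      quadPhase M n * quadPhase M m * Complex.exp (2 * π * Complex.I * (n * m) / M) := by
  rw [quadPhase, quadPhase, quadPhase, ← Complex.exp_add, ← Complex.exp_add]
  congr 1
  push_cast
  ring

lemma quadPhase_neg (M : ℕ) (n : ℤ) : quadPhase M (-n) = quadPhase M n := by
  simp [quadPhase]

lemma quadPhase_ne_zero (M : ℕ) (n : ℤ) : quadPhase M n ≠ 0 := Complex.exp_ne_zero _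

lemma sum_range_add_of_periodic (M : ℕ) (f : ℤ → ℂ) (hf : ∀ n, f (n + M) = f n) (c : ℤ) :
    ∑ r ∈ Finset.range M, f (r + c) = ∑ r ∈ Finset.range M, f r := by
  have hstep : ∀ c : ℤ, ∑ r ∈ Finset.range M, f (r + (c + 1)) =
      ∑ r ∈ Finset.range M, f (r + c) := fun c ↦ by
    have h := (Finset.sum_range_succ (fun r : ℕ ↦ f (r + c)) M).symm.trans
      (Finset.sum_range_succ' (fun r : ℕ ↦ f (r + c)) M)
    rw [add_comm (M : ℤ) c, hf, Nat.cast_zero, zero_add, add_right_cancel_iff] at h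
    rw [h]
    refine Finset.sum_congr rfl fun r _ ↦ ?_
    push_cast
    ring_nf
  induction c using Int.induction_on with
  | zero => simp
  | succ i ih => rw [hstep, ih]
  | pred i ih => rw [← ih, ← hstep, sub_add_cancel]

lemma sum_quadPhase_mul_exp (M : ℕ) [NeZero M] (hM : Even M) (c : ℤ) :
    ∑ r ∈ Finset.range M, quadPhase M r * Complex.exp (2 * π * Complex.I * (r * c) / M) =
      (√M : ℝ) * Complex.exp (π / 4 * Complex.I) / quadPhase M c := by
  have hp : ∀ n : ℤ, quadPhase M (n + M) = quadPhase M n := fun n ↦ by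
    simpa [add_comm] using quadPhase_add_mul M hM n 1
  rw [eq_div_iff (quadPhase_ne_zero M c), ← sum_quadPhase M hM,
    Fin.sum_univ_eq_sum_range (fun r : ℕ ↦ quadPhase M r), ← sum_range_add_of_periodic M _ hp c,
    Finset.sum_mul]
  refine Finset.sum_congr rfl fun r _ ↦ ?_
  rw [quadPhase_add, Int.cast_natCast]
  ring

/-- Folding a sum over a full period, for an even summand vanishing at the fixed points. -/
lemma sum_range_two_mul_of_even (k : ℕ) (f : ℤ → ℂ) (hf : ∀ n, f (n + 2 * (k + 2)) = f n)
    (he : ∀ n, f (-n) = f n) (h0 : f 0 = 0) (hN : f (k + 2) = 0) :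
    ∑ r ∈ Finset.range (2 * (k + 2)), f r = 2 * ∑ r ∈ Finset.range (k + 1), f (r + 1) := by
  rw [two_mul (k + 2), Finset.sum_range_add, Finset.sum_range_succ' (fun r : ℕ ↦ f r),
    Finset.sum_range_succ' (fun r : ℕ ↦ f ((k + 2 + r : ℕ) : ℤ)), two_mul]
  simp only [Nat.cast_zero, h0, add_zero, Nat.cast_add, Nat.cast_ofNat, hN, Nat.cast_one]
  congr 1
  rw [← Finset.sum_range_reflect]
  refine Finset.sum_congr rfl fun r hr ↦ ?_
  have hr' : r ≤ k := Nat.lt_succ_iff.mp (Finset.mem_range.mp hr)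
  rw [← he ((r : ℤ) + 1), ← hf (-((r : ℤ) + 1))]
  congr 1
  rw [show k + 1 - 1 - r = k - r by omega]
  push_cast [hr']
  ring

lemma sum_sin_mul_sin_mul_quadPhase (k : ℕ) (a b : ℤ) :
    ∑ r ∈ Finset.range (k + 1), Complex.sin (a * (r + 1) * π / (k + 2)) *
        Complex.sin ((r + 1) * b * π / (k + 2)) * quadPhase (2 * (k + 2)) (r + 1) =
      (√(2 * (k + 2)) : ℝ) * Complex.exp (π / 4 * Complex.I) * Complex.I / 2 *
        Complex.sin (a * b * π / (k + 2)) /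
          (quadPhase (2 * (k + 2)) a * quadPhase (2 * (k + 2)) b) := by
  have hk : (k : ℂ) + 2 ≠ 0 := by exact_mod_cast (show k + 2 ≠ 0 by omega)
  have hMe : Even (2 * (k + 2)) := even_two_mul _
  have hq : ∀ n : ℤ, quadPhase (2 * (k + 2)) (n + 2 * (k + 2)) = quadPhase (2 * (k + 2)) n :=
    fun n ↦ by simpa [add_comm] using quadPhase_add_mul (2 * (k + 2)) hMe n 1
  have hsin : ∀ c n : ℤ, Complex.sin (c * ((n + 2 * (k + 2) : ℤ) : ℂ) * π / (k + 2)) =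
      Complex.sin (c * n * π / (k + 2)) := fun c n ↦ by
    rw [← Complex.sin_add_int_mul_two_pi (c * n * π / (k + 2)) c]
    congr 1
    push_cast
    field_simp
  have hsinN : ∀ c : ℤ, Complex.sin (c * ((k + 2 : ℤ) : ℂ) * π / (k + 2)) = 0 := fun c ↦ by
    rw [← Complex.sin_int_mul_pi c]
    congr 1
    push_cast
    field_simp
  have hfold := sum_range_two_mul_of_even k (fun n ↦ Complex.sin (a * n * π / (k + 2)) *
    Complex.sin (b * n * π / (k + 2)) * quadPhase (2 * (k + 2)) n)
    (fun n ↦ by simp only [hsin, hq])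
    (fun n ↦ by
      simp only [quadPhase_neg, Int.cast_neg, mul_neg, neg_mul, neg_div, Complex.sin_neg, neg_neg])
    (by simp) (by simp only [hsinN, zero_mul])
  have hexp : ∀ r : ℕ, Complex.sin (a * ((r : ℤ) : ℂ) * π / (k + 2)) *
      Complex.sin (b * ((r : ℤ) : ℂ) * π / (k + 2)) * quadPhase (2 * (k + 2)) r =
      (quadPhase (2 * (k + 2)) r *
          Complex.exp (2 * π * Complex.I * (r * ((a - b : ℤ) : ℂ)) / (2 * (k + 2) : ℕ)) +
        quadPhase (2 * (k + 2)) r *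
          Complex.exp (2 * π * Complex.I * (r * ((b - a : ℤ) : ℂ)) / (2 * (k + 2) : ℕ)) -
        quadPhase (2 * (k + 2)) r *
          Complex.exp (2 * π * Complex.I * (r * ((a + b : ℤ) : ℂ)) / (2 * (k + 2) : ℕ)) -
        quadPhase (2 * (k + 2)) r *
          Complex.exp (2 * π * Complex.I * (r * ((-a - b : ℤ) : ℂ)) / (2 * (k + 2) : ℕ))) / 4 :=
    fun r ↦ by
    have h : ∀ e f : ℤ, Complex.exp (2 * π * Complex.I * (r * ((e + f : ℤ) : ℂ)) /
        (2 * (k + 2) : ℕ)) = Complex.exp (e * r * π / (k + 2) * Complex.I) *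
          Complex.exp (f * r * π / (k + 2) * Complex.I) := fun e f ↦ by
      rw [← Complex.exp_add]
      congr 1
      push_cast
      field_simp
    have hneg : ∀ e : ℤ, Complex.exp (((-e : ℤ) : ℂ) * r * π / (k + 2) * Complex.I) =
        Complex.exp (-(e * r * π / (k + 2)) * Complex.I) := fun e ↦ by
      congr 1
      push_cast
      ring
    rw [sub_eq_add_neg a, sub_eq_add_neg b, sub_eq_add_neg (-a), h, h, h, h, hneg, hneg,
      Complex.sin, Complex.sin, Int.cast_natCast]
    linear_combination (quadPhase (2 * (k + 2)) r / 4 *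
      (Complex.exp (-(a * r * π / (k + 2)) * Complex.I) -
        Complex.exp (a * r * π / (k + 2) * Complex.I)) *
      (Complex.exp (-(b * r * π / (k + 2)) * Complex.I) -
        Complex.exp (b * r * π / (k + 2) * Complex.I))) * Complex.I_sq
  simp_rw [hexp] at hfold
  rw [← Finset.sum_div, Finset.sum_sub_distrib, Finset.sum_sub_distrib, Finset.sum_add_distrib,
    sum_quadPhase_mul_exp _ hMe, sum_quadPhase_mul_exp _ hMe, sum_quadPhase_mul_exp _ hMe,
    sum_quadPhase_mul_exp _ hMe, ← neg_sub a b, quadPhase_neg,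
    show -a - b = -(a + b) by ring, quadPhase_neg, sub_eq_add_neg a b, quadPhase_add, quadPhase_add,
    quadPhase_neg] at hfold
  have hE : Complex.exp (2 * π * Complex.I * (a * b) / (2 * (k + 2) : ℕ)) =
      Complex.exp (a * b * π / (k + 2) * Complex.I) := by
    congr 1
    push_cast
    field_simp
  have hE' : Complex.exp (2 * π * Complex.I * (a * ((-b : ℤ) : ℂ)) / (2 * (k + 2) : ℕ)) =
      (Complex.exp (a * b * π / (k + 2) * Complex.I))⁻¹ := by
    rw [← Complex.exp_neg]
    congr 1
    push_cast
    field_simp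
  have hS : Complex.sin (a * b * π / (k + 2)) =
      ((Complex.exp (a * b * π / (k + 2) * Complex.I))⁻¹ -
        Complex.exp (a * b * π / (k + 2) * Complex.I)) * Complex.I / 2 := by
    rw [Complex.sin, neg_mul, Complex.exp_neg]
  rw [hE, hE'] at hfold
  have hL : ∑ r ∈ Finset.range (k + 1), Complex.sin (a * (r + 1) * π / (k + 2)) *
        Complex.sin ((r + 1) * b * π / (k + 2)) * quadPhase (2 * (k + 2)) (r + 1) =
      ∑ r ∈ Finset.range (k + 1), Complex.sin (a * (((r : ℤ) + 1 : ℤ) : ℂ) * π / (k + 2)) *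
        Complex.sin (b * (((r : ℤ) + 1 : ℤ) : ℂ) * π / (k + 2)) *
          quadPhase (2 * (k + 2)) (r + 1) :=
    Finset.sum_congr rfl fun r _ ↦ by push_cast; rw [mul_comm (b : ℂ)]
  rw [hL, hS]
  have hfold' := (eq_div_iff_mul_eq two_ne_zero).mpr ((mul_comm _ _).trans hfold.symm)
  rw [hfold']
  have hx := Complex.exp_ne_zero (a * b * π / (k + 2) * Complex.I)
  generalize Complex.exp (a * b * π / (k + 2) * Complex.I) = X at *
  have ha := quadPhase_ne_zero (2 * (k + 2)) a
  have hb := quadPhase_ne_zero (2 * (k + 2)) b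
  push_cast
  field_simp
  rw [Complex.I_sq]
  ring

lemma SU2tmatrix_eq_diagonal (k : ℕ) :
    SU2tmatrix k = Matrix.diagonal fun a : Fin (k + 1) ↦
      quadPhase (2 * (k + 2)) ((a : ℕ) + 1) * Complex.exp (-(π / 4 * Complex.I)) := by
  have hk : (k : ℂ) + 2 ≠ 0 := by exact_mod_cast (show k + 2 ≠ 0 by omega)
  ext a b
  rw [SU2tmatrix, Matrix.diagonal_apply]
  split_ifs
  · rw [quadPhase, ← Complex.exp_add]
    congr 1
    push_cast
    field_simp
    ring
  · rfl

lemma SU2tmatrix_mul_braid (k : ℕ) :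
    SU2tmatrix k * (SU2smatrixC k * SU2tmatrix k * SU2smatrixC k) * SU2tmatrix k =
      SU2smatrixC k := by
  ext a b
  rw [SU2tmatrix_eq_diagonal, Matrix.mul_diagonal, Matrix.diagonal_mul, Matrix.mul_apply]
  simp only [Matrix.mul_diagonal, SU2smatrixC]
  have h := sum_sin_mul_sin_mul_quadPhase k ((a : ℕ) + 1) ((b : ℕ) + 1)
  push_cast at h ⊢
  have hsum : ∑ x : Fin (k + 1), ((√(2 / (k + 2)) : ℝ) : ℂ) *
        Complex.sin (((a : ℕ) + 1) * ((x : ℕ) + 1) * π / (k + 2)) *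
        (quadPhase (2 * (k + 2)) ((x : ℕ) + 1) * Complex.exp (-(π / 4 * Complex.I))) *
        (((√(2 / (k + 2)) : ℝ) : ℂ) *
          Complex.sin (((x : ℕ) + 1) * ((b : ℕ) + 1) * π / (k + 2))) =
      ((√(2 / (k + 2)) : ℝ) : ℂ) ^ 2 * Complex.exp (-(π / 4 * Complex.I)) *
      ∑ r ∈ Finset.range (k + 1), Complex.sin (((a : ℕ) + 1) * (r + 1) * π / (k + 2)) *
        Complex.sin ((r + 1) * ((b : ℕ) + 1) * π / (k + 2)) *
          quadPhase (2 * (k + 2)) (r + 1) := by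
    rw [← Fin.sum_univ_eq_sum_range (fun r : ℕ ↦
      Complex.sin (((a : ℕ) + 1) * (r + 1) * π / (k + 2)) *
        Complex.sin ((r + 1) * ((b : ℕ) + 1) * π / (k + 2)) *
          quadPhase (2 * (k + 2)) (r + 1)), Finset.mul_sum]
    exact Finset.sum_congr rfl fun x _ ↦ by ring
  rw [hsum, h]
  have hsq : ((√(2 / (k + 2)) : ℝ) : ℂ) * ((√(2 * (k + 2)) : ℝ) : ℂ) = 2 := by
    rw [← Complex.ofReal_mul, ← Real.sqrt_mul (by positivity),
      show (2 / (k + 2) * (2 * (k + 2)) : ℝ) = 2 ^ 2 by field_simp,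
      Real.sqrt_sq zero_le_two, Complex.ofReal_ofNat]
  have hI : Complex.exp (π / 4 * Complex.I) ^ 2 = Complex.I := by
    rw [← Complex.exp_nat_mul, show ((2 : ℕ) : ℂ) * (π / 4 * Complex.I) = π / 2 * Complex.I by
      push_cast; ring, Complex.exp_pi_div_two_mul_I]
  have ha := quadPhase_ne_zero (2 * (k + 2)) ((a : ℕ) + 1)
  have hb := quadPhase_ne_zero (2 * (k + 2)) ((b : ℕ) + 1)
  have hX := Complex.exp_ne_zero (π / 4 * Complex.I)
  rw [Complex.exp_neg]
  generalize Complex.exp (π / 4 * Complex.I) = X at hI hX ⊢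
  generalize Complex.sin (((a : ℕ) + 1) * ((b : ℕ) + 1) * π / (k + 2)) = s
  field_simp
  rw [hI]
  linear_combination (√(2 / (k + 2)) : ℝ) * Complex.I * s * hsq

/-- The explicit `SU(2)_k` modular matrices satisfy the modular group relation
`(S·T)³ = S²`. -/
theorem SU2_modular_relation (k : ℕ) :
    (SU2smatrixC k * SU2tmatrix k) ^ 3 = SU2smatrixC k ^ 2 := by
  calc (SU2smatrixC k * SU2tmatrix k) ^ 3 = SU2smatrixC k *
      (SU2tmatrix k * (SU2smatrixC k * SU2tmatrix k * SU2smatrixC k) * SU2tmatrix k) := by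
        noncomm_ring
    _ = SU2smatrixC k ^ 2 := by rw [SU2tmatrix_mul_braid, sq]
end

section
/- For every natural number k, the Verlinde fusion coefficients of SU(2)_k, defined by N_{ab}^c = ∑_{x=0}^{k} S a x · S b x · S c x / S 0 x with S a b = √(2/(k+2)) · sin((a+1)(b+1)π/(k+2)), satisfy: N_{ab}^c = 1 if |a − b| ≤ c ≤ min(a + b, 2k − a − b) and a + b + c is even, and N_{ab}^c = 0 otherwise. In particular each fusion coefficient is 0 or 1. -/
open scoped Real

lemma two_mul_sin_mul_sum_cos (x : ℝ) (n : ℕ) :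
    2 * Real.sin (x / 2) * ∑ m ∈ Finset.range n, Real.cos (m * x) =
      Real.sin (n * x - x / 2) + Real.sin (x / 2) := by
  induction n with
  | zero => simp
  | succ n ih =>
    rw [Finset.sum_range_succ, mul_add, ih]
    have h : ((n + 1 : ℕ) : ℝ) * x - x / 2 = n * x + x / 2 := by push_cast; ring
    rw [h, Real.sin_add, Real.sin_sub]
    ring

lemma sum_cos_int_mul_pi_div {n : ℕ} (hn : 0 < n) (q : ℤ) :
    ∑ m ∈ Finset.range n, Real.cos (m * (q * π / n)) =
      (if (2 * n : ℤ) ∣ q then (n : ℝ) else 0) + (1 - (-1) ^ q) / 2 := by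
  have hn' : (n : ℝ) ≠ 0 := by positivity
  split_ifs with h
  · obtain ⟨r, rfl⟩ := h
    have hcos (m : ℕ) : Real.cos (m * ((2 * n * r : ℤ) * π / n)) = 1 := by
      rw [← Real.cos_int_mul_two_pi (m * r)]
      congr 1
      push_cast
      field_simp
    have hpow : (-1 : ℝ) ^ (2 * (n : ℤ) * r) = 1 :=
      Even.neg_one_zpow ⟨n * r, by ring⟩
    simp only [hcos, hpow]
    simp
  · have hsin : Real.sin (q * π / n / 2) ≠ 0 := by
      intro h0
      obtain ⟨r, hr⟩ := Real.sin_eq_zero_iff.1 h0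
      refine h ⟨r, ?_⟩
      field_simp at hr
      exact_mod_cast (by linarith : (q : ℝ) = 2 * n * r)
    have key := two_mul_sin_mul_sum_cos (q * π / n) n
    have harg : (n : ℝ) * (q * π / n) - q * π / n / 2 = q * π - q * π / n / 2 := by
      field_simp
    rw [harg, Real.sin_sub, Real.sin_int_mul_pi, Real.cos_int_mul_pi] at key
    apply mul_left_cancel₀ hsin
    linear_combination key / 2

/-- Discrete orthogonality of the sines `m ↦ sin (m p π / n)`. -/
lemma sum_sin_mul_sin_pi_div {n : ℕ} (hn : 0 < n) (p q : ℤ) :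
    2 / (n : ℝ) * ∑ m ∈ Finset.range n,
        Real.sin (m * (p * π / n)) * Real.sin (m * (q * π / n)) =
      (if (2 * n : ℤ) ∣ p - q then 1 else 0) - (if (2 * n : ℤ) ∣ p + q then 1 else 0) := by
  have hn' : (n : ℝ) ≠ 0 := by positivity
  have hprod (m : ℕ) : Real.sin (m * (p * π / n)) * Real.sin (m * (q * π / n)) =
      (Real.cos (m * ((p - q : ℤ) * π / n)) - Real.cos (m * ((p + q : ℤ) * π / n))) / 2 := by
    have h₁ : (m : ℝ) * ((p - q : ℤ) * π / n) = m * (p * π / n) - m * (q * π / n) := by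
      push_cast; ring
    have h₂ : (m : ℝ) * ((p + q : ℤ) * π / n) = m * (p * π / n) + m * (q * π / n) := by
      push_cast; ring
    rw [h₁, h₂, Real.cos_sub, Real.cos_add]
    ring
  have hpow : (-1 : ℝ) ^ (p + q) = (-1) ^ (p - q) := by
    rw [show p + q = p - q + 2 * q by ring, zpow_add₀ (by norm_num), zpow_mul]
    simp
  simp only [hprod]
  rw [← Finset.sum_div, Finset.sum_sub_distrib, sum_cos_int_mul_pi_div hn,
    sum_cos_int_mul_pi_div hn, hpow]
  split_ifs <;> field_simp <;> ring

lemma sin_mul_sin_eq_sin_mul_sum (s φ : ℝ) (N : ℕ) :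
    Real.sin ((s + N) * φ) * Real.sin (N * φ) =
      Real.sin φ * ∑ j ∈ Finset.range N, Real.sin ((s + 1 + 2 * j) * φ) := by
  induction N with
  | zero => simp
  | succ N ih =>
    rw [Finset.sum_range_succ, mul_add, ← ih]
    have h₁ : (s + 1 + 2 * N) * φ = (s + N) * φ + N * φ + φ := by ring
    have h₂ : (s + (N + 1 : ℕ)) * φ = (s + N) * φ + φ := by push_cast; ring
    have h₃ : ((N + 1 : ℕ) : ℝ) * φ = N * φ + φ := by push_cast; ring
    rw [h₁, h₂, h₃]
    generalize (s + N) * φ = u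
    generalize (N : ℝ) * φ = v
    simp only [Real.sin_add, Real.cos_add]
    linear_combination Real.sin u * Real.sin v * Real.sin_sq_add_cos_sq φ

lemma sum_range_ite_add_two_mul_eq (s t N : ℕ) :
    ∑ j ∈ Finset.range N, (if s + 2 * j = t then (1 : ℝ) else 0) =
      if s ≤ t ∧ t < s + 2 * N ∧ (s + t) % 2 = 0 then 1 else 0 := by
  induction N with
  | zero => rw [if_neg (by omega)]; simp
  | succ N ih =>
    rw [Finset.sum_range_succ, ih]
    split_ifs <;> first | omega | norm_num

lemma SU2smatrix_verlinde_summand {k : ℕ} {a b : Fin (k + 1)} (hab : b ≤ a)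
    (c x : Fin (k + 1)) :
    SU2smatrix k a x * SU2smatrix k b x * SU2smatrix k c x / SU2smatrix k 0 x =
      2 / ((k + 2 : ℕ) : ℝ) * ∑ j ∈ Finset.range (b + 1),
        Real.sin ((x + 1 : ℕ) * (((a - b + 1 + 2 * j : ℕ) : ℤ) * π / (k + 2 : ℕ))) *
          Real.sin ((x + 1 : ℕ) * (((c + 1 : ℕ) : ℤ) * π / (k + 2 : ℕ))) := by
  have hab' : (b : ℕ) ≤ a := hab
  set φ : ℝ := (x + 1) * π / (k + 2) with hφ
  have hk : (0 : ℝ) < k + 2 := by positivity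
  have hsqrt : Real.sqrt (2 / (k + 2)) * Real.sqrt (2 / (k + 2)) = 2 / (k + 2 : ℝ) :=
    Real.mul_self_sqrt (by positivity)
  have hsqrt₀ : Real.sqrt (2 / (k + 2)) ≠ 0 := by positivity
  have hsin : Real.sin φ ≠ 0 := by
    refine (Real.sin_pos_of_pos_of_lt_pi (by positivity) ?_).ne'
    rw [hφ, div_lt_iff₀ hk, mul_comm]
    have : (x : ℝ) < k + 1 := by exact_mod_cast x.isLt
    exact mul_lt_mul_of_pos_left (by linarith) Real.pi_pos
  have hS (d : Fin (k + 1)) :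
      SU2smatrix k d x = Real.sqrt (2 / (k + 2)) * Real.sin ((d + 1) * φ) := by
    rw [SU2smatrix, hφ]
    congr 2
    ring
  have hfus := sin_mul_sin_eq_sin_mul_sum ((a : ℝ) - b) φ (b + 1)
  have hterm (j : ℕ) : ((x + 1 : ℕ) : ℝ) * (((a - b + 1 + 2 * j : ℕ) : ℤ) * π / (k + 2 : ℕ)) =
      ((a : ℝ) - b + 1 + 2 * j) * φ := by
    rw [hφ]
    push_cast [Nat.cast_sub hab']
    ring
  have hC : ((x + 1 : ℕ) : ℝ) * (((c + 1 : ℕ) : ℤ) * π / (k + 2 : ℕ)) = (c + 1) * φ := by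
    rw [hφ]
    push_cast
    ring
  simp only [hterm, hC]
  rw [← Finset.sum_mul, hS, hS, hS, hS]
  push_cast at hfus ⊢
  rw [show (a : ℝ) - b + (b + 1) = a + 1 by ring] at hfus
  simp only [Fin.val_zero, Nat.cast_zero, zero_add, one_mul]
  rw [div_eq_iff (mul_ne_zero hsqrt₀ hsin)]
  linear_combination Real.sqrt (2 / (k + 2)) ^ 3 * Real.sin ((c + 1) * φ) * hfus +
    Real.sqrt (2 / (k + 2)) * Real.sin ((c + 1) * φ) * Real.sin φ *
      (∑ j ∈ Finset.range ((b : ℕ) + 1), Real.sin ((a - b + 1 + 2 * j) * φ)) * hsqrt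

lemma SU2_verlinde_fusion_rule_of_le {k : ℕ} {a b : Fin (k + 1)} (hab : b ≤ a)
    (c : Fin (k + 1)) :
    (∑ x : Fin (k + 1),
        SU2smatrix k a x * SU2smatrix k b x * SU2smatrix k c x / SU2smatrix k 0 x) =
      if (a : ℕ) - (b : ℕ) ≤ (c : ℕ) ∧ (b : ℕ) - (a : ℕ) ≤ (c : ℕ) ∧
          (c : ℕ) ≤ min ((a : ℕ) + (b : ℕ)) (2 * k - (a : ℕ) - (b : ℕ)) ∧
          ((a : ℕ) + (b : ℕ) + (c : ℕ)) % 2 = 0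
      then 1 else 0 := by
  have hab' : (b : ℕ) ≤ a := hab
  have ha := a.isLt
  have hc := c.isLt
  have horth (j : ℕ) (hj : j ∈ Finset.range (b + 1)) :
      2 / ((k + 2 : ℕ) : ℝ) * ∑ x : Fin (k + 1),
        Real.sin ((x + 1 : ℕ) * (((a - b + 1 + 2 * j : ℕ) : ℤ) * π / (k + 2 : ℕ))) *
          Real.sin ((x + 1 : ℕ) * (((c + 1 : ℕ) : ℤ) * π / (k + 2 : ℕ))) =
      (if a - b + 1 + 2 * j = (c + 1 : ℕ) then 1 else 0) -
        (if a - b + 1 + 2 * j = 2 * k + 3 - c then 1 else 0) := by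
    have hj' := Finset.mem_range.1 hj
    have h := sum_sin_mul_sin_pi_div (n := k + 2) (by omega)
      ((a - b + 1 + 2 * j : ℕ) : ℤ) ((c + 1 : ℕ) : ℤ)
    rw [Finset.sum_range_succ'] at h
    simp only [Nat.cast_zero, zero_mul, Real.sin_zero, add_zero] at h
    rw [Fin.sum_univ_eq_sum_range (fun x : ℕ =>
      Real.sin ((x + 1 : ℕ) * (((a - b + 1 + 2 * j : ℕ) : ℤ) * π / (k + 2 : ℕ))) *
        Real.sin ((x + 1 : ℕ) * (((c + 1 : ℕ) : ℤ) * π / (k + 2 : ℕ)))), h]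
    congr 1
    · refine if_congr ⟨fun hd => ?_, fun he => ?_⟩ rfl rfl
      · have := Int.eq_zero_of_abs_lt_dvd hd (by rw [abs_lt]; constructor <;> omega)
        omega
      · simp [he]
    · refine if_congr ⟨fun hd => ?_, fun he => ?_⟩ rfl rfl
      · have := Int.eq_zero_of_abs_lt_dvd (dvd_sub_self_right.2 hd)
          (by rw [abs_lt]; constructor <;> omega)
        omega
      · exact ⟨1, by omega⟩
  simp only [SU2smatrix_verlinde_summand hab]
  rw [← Finset.mul_sum, Finset.sum_comm, Finset.mul_sum, Finset.sum_congr rfl horth,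
    Finset.sum_sub_distrib, sum_range_ite_add_two_mul_eq, sum_range_ite_add_two_mul_eq]
  split_ifs <;> first | omega | norm_num

/-- The Verlinde fusion coefficients of `SU(2)_k` realize the level-`k` truncated
`SU(2)` tensor product rule: `N_{ab}^c = 1` if `|a − b| ≤ c ≤ min(a + b, 2k − a − b)`
and `a + b + c` is even, and `N_{ab}^c = 0` otherwise.  In particular each fusion
coefficient is `0` or `1`. -/
theorem SU2_verlinde_fusion_rule (k : ℕ) (a b c : Fin (k + 1)) :
    (∑ x : Fin (k + 1),
        SU2smatrix k a x * SU2smatrix k b x * SU2smatrix k c x / SU2smatrix k 0 x) =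
      if (a : ℕ) - (b : ℕ) ≤ (c : ℕ) ∧ (b : ℕ) - (a : ℕ) ≤ (c : ℕ) ∧
          (c : ℕ) ≤ min ((a : ℕ) + (b : ℕ)) (2 * k - (a : ℕ) - (b : ℕ)) ∧
          ((a : ℕ) + (b : ℕ) + (c : ℕ)) % 2 = 0
      then 1 else 0 := by
  rcases le_total b a with hab | hab
  · exact SU2_verlinde_fusion_rule_of_le hab c
  · simp only [mul_comm (SU2smatrix k a _) (SU2smatrix k b _)]
    rw [SU2_verlinde_fusion_rule_of_le hab c]
    refine if_congr ?_ rfl rfl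
    omega
end
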